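/- Let M be a computable structure that is ultrahomogeneous. Then M is EmbedInfo(M)-computably ultrahomogeneous, where EmbedInfo(M) = EmbedInfo(𝕂[M]). -/

import Mathlib

/- Self-contained framework for computable ages and cofinal Fraïssé limits. -/

namespace CFL

open Classical

/-! ### Oracle computability -/

/-- The characteristic partial function of a set of naturals. -/
noncomputable def chi (A : Set ℕ) : ℕ →. ℕ :=
  fun n => Part.some (if n ∈ A then 1 else 0)

/-- Codes for oracle partial recursive functions. -/
inductive OCode : Type
  | zero : OCode
  | succ : OCode
  | left : OCode
  | right : OCode
  | oracle : OCode
  | pair : OCode → OCode → OCode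
  | comp : OCode → OCode → OCode
  | prec : OCode → OCode → OCode
  | rfind' : OCode → OCode

/-- Evaluation of an oracle code relative to an oracle `O`. -/
def OCode.eval (O : ℕ →. ℕ) : OCode → ℕ →. ℕ
  | OCode.zero => pure 0
  | OCode.succ => Nat.succ
  | OCode.left => ↑fun n : ℕ => n.unpair.1
  | OCode.right => ↑fun n : ℕ => n.unpair.2
  | OCode.oracle => O
  | OCode.pair cf cg => fun n => Nat.pair <$> OCode.eval O cf n <*> OCode.eval O cg n
  | OCode.comp cf cg => fun n => OCode.eval O cg n >>= OCode.eval O cf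
  | OCode.prec cf cg =>
    Nat.unpaired fun a n =>
      n.rec (OCode.eval O cf a) fun y IH => do
        let i ← IH
        OCode.eval O cg (Nat.pair a (Nat.pair y i))
  | OCode.rfind' cf =>
    Nat.unpaired fun a m =>
      (Nat.rfind fun n => (fun m => m = 0) <$> OCode.eval O cf (Nat.pair a (n + m))).map
        (· + m)

/-- A numerical code of an `OCode`. -/
def OCode.encodeCode : OCode → ℕ
  | OCode.zero => 0
  | OCode.succ => 1
  | OCode.left => 2
  | OCode.right => 3
  | OCode.oracle => 4
  | OCode.pair cf cg => 4 * Nat.pair cf.encodeCode cg.encodeCode + 5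
  | OCode.comp cf cg => 4 * Nat.pair cf.encodeCode cg.encodeCode + 6
  | OCode.prec cf cg => 4 * Nat.pair cf.encodeCode cg.encodeCode + 7
  | OCode.rfind' cf => 4 * cf.encodeCode + 8

/-- `f` is a partial function recursive in the oracle set `O`. -/
def RecFunIn (O : Set ℕ) (f : ℕ →. ℕ) : Prop :=
  ∃ c : OCode, OCode.eval (chi O) c = f

/-- The code `c` computes the total function `f` relative to the oracle set `O`. -/
def ComputesIn (O : Set ℕ) (c : OCode) (f : ℕ → ℕ) : Prop :=
  ∀ n, OCode.eval (chi O) c n = Part.some (f n)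

/-- `f` is a total function computable in the oracle set `O`. -/
def TotalComputableIn (O : Set ℕ) (f : ℕ → ℕ) : Prop :=
  ∃ c : OCode, ComputesIn O c f

/-- The set `A` is computable in the oracle set `O`. -/
def SetRecIn (O A : Set ℕ) : Prop := RecFunIn O (chi A)

/-- Turing reducibility (on sets of naturals, regarded as representatives of
Turing degrees). -/
def TuringLE (A B : Set ℕ) : Prop := SetRecIn B A

/-- The set `A` is computably enumerable in the oracle set `O`. -/
def CEIn (O A : Set ℕ) : Prop :=
  ∃ c : OCode, ∀ n, n ∈ A ↔ (OCode.eval (chi O) c n).Dom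

/-- The Turing jump of a set of naturals. -/
def jump (O : Set ℕ) : Set ℕ :=
  { e | ∃ c : OCode, c.encodeCode = (Nat.unpair e).1 ∧
      (OCode.eval (chi O) c (Nat.unpair e).2).Dom }

/-- `0'`, the jump of the least degree. -/
def zeroJump : Set ℕ := jump ∅

/-- `0''`. -/
def zeroJump2 : Set ℕ := jump zeroJump

/-- `0'''`. -/
def zeroJump3 : Set ℕ := jump zeroJump2

/-! ### Languages and structures -/

/-- A (coded) first-order language: `relArity r = some k` means that `r` is the code of a
relation symbol of arity `k`, and similarly for function symbols. -/
structure Lang where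
  relArity : ℕ → Option ℕ
  funArity : ℕ → Option ℕ

/-- The language is computably represented. -/
def Lang.ComputableRep (L : Lang) : Prop :=
  TotalComputableIn ∅ (fun r => Encodable.encode (L.relArity r)) ∧
  TotalComputableIn ∅ (fun f => Encodable.encode (L.funArity f))

/-- A finite relational language. -/
def Lang.FiniteRelational (L : Lang) : Prop :=
  (∀ f, L.funArity f = none) ∧ { r | (L.relArity r).isSome = true }.Finite

/-- A finite language. -/
def Lang.FiniteLang (L : Lang) : Prop :=
  { r | (L.relArity r).isSome = true }.Finite ∧
  { f | (L.funArity f).isSome = true }.Finite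

/-- An `L`-structure with underlying set a set of naturals. -/
structure Str (L : Lang) where
  dom : Set ℕ
  rel : ℕ → List ℕ → Prop
  fn : ℕ → List ℕ → ℕ
  rel_valid : ∀ r as, rel r as → L.relArity r = some as.length ∧ ∀ x ∈ as, x ∈ dom
  fn_mem : ∀ f as, L.funArity f = some as.length → (∀ x ∈ as, x ∈ dom) → fn f as ∈ dom

variable {L : Lang}

/-- The (finite) tuple `as` lies in the structure `A`. -/
def TupleIn (A : Str L) (as : List ℕ) : Prop := ∀ x ∈ as, x ∈ A.dom

/-- Membership in the substructure of `A` generated by the tuple `s`. -/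
inductive InClosure (A : Str L) (s : List ℕ) : ℕ → Prop
  | base {x : ℕ} : x ∈ s → x ∈ A.dom → InClosure A s x
  | fn (f : ℕ) (as : List ℕ) : L.funArity f = some as.length →
      (∀ x ∈ as, InClosure A s x) → InClosure A s (A.fn f as)

theorem InClosure.mem_dom {A : Str L} {s : List ℕ} {x : ℕ}
    (h : InClosure A s x) : x ∈ A.dom := by
  induction h with
  | base _ hx => exact hx
  | fn f as ha _ ih => exact A.fn_mem f as ha ih

/-- The substructure of `A` generated by the tuple `s`. -/
def Str.sub (A : Str L) (s : List ℕ) : Str L where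
  dom := { x | InClosure A s x }
  rel r as := A.rel r as ∧ ∀ x ∈ as, InClosure A s x
  fn := A.fn
  rel_valid := fun r as h => ⟨(A.rel_valid r as h.1).1, h.2⟩
  fn_mem := fun f as ha hm => InClosure.fn f as ha hm

/-- `h` is an embedding of `A` into `B`. -/
def IsEmbMap (A B : Str L) (h : ℕ → ℕ) : Prop :=
  (∀ x ∈ A.dom, h x ∈ B.dom) ∧
  (∀ x ∈ A.dom, ∀ y ∈ A.dom, h x = h y → x = y) ∧
  (∀ r as, TupleIn A as → (A.rel r as ↔ B.rel r (as.map h))) ∧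
  (∀ f as, L.funArity f = some as.length → TupleIn A as →
    h (A.fn f as) = B.fn f (as.map h))

/-- `A` embeds into `B`. -/
def Embeds (A B : Str L) : Prop := ∃ h, IsEmbMap A B h

/-- `h` is an isomorphism of `A` onto `B`. -/
def IsIsoMap (A B : Str L) (h : ℕ → ℕ) : Prop :=
  IsEmbMap A B h ∧ ∀ y ∈ B.dom, ∃ x ∈ A.dom, h x = y

/-- `A` and `B` are isomorphic. -/
def Isom (A B : Str L) : Prop := ∃ h, IsIsoMap A B h

/-- `as ∼cl bs`: the coordinatewise map extends to an isomorphism of generated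
substructures. -/
def ClSim (A : Str L) (as : List ℕ) (B : Str L) (bs : List ℕ) : Prop :=
  ∃ h : ℕ → ℕ, as.map h = bs ∧ IsIsoMap (A.sub as) (B.sub bs) h

/-- `as ∼tuple bs`: equal length and the same pattern of equalities among coordinates. -/
def TupleSim (as bs : List ℕ) : Prop :=
  ∃ h h' : ℕ → ℕ, as.map h = bs ∧ bs.map h' = as

/-- `A` is finitely generated. -/
def Str.FG (A : Str L) : Prop :=
  ∃ s : List ℕ, TupleIn A s ∧ ∀ x, x ∈ A.dom ↔ InClosure A s x

/-- `g` is an automorphism of `M`. -/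
def IsAutoOf (M : Str L) (g : ℕ → ℕ) : Prop := IsIsoMap M M g

/-! ### Ages (as isomorphism-closed classes) -/

/-- `B` belongs to the age of `M`, i.e. `B` is isomorphic to a finitely generated
substructure of `M`. -/
def AgeMemOf (M : Str L) (B : Str L) : Prop :=
  ∃ as : List ℕ, TupleIn M as ∧ Isom B (M.sub as)

/-- The age of a structure `M`. -/
def ageOf (M : Str L) : Set (Str L) := { B | AgeMemOf M B }

/-- The hereditary property. -/
def HP (C : Set (Str L)) : Prop :=
  ∀ B ∈ C, ∀ as : List ℕ, TupleIn B as → B.sub as ∈ C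

/-- The joint embedding property. -/
def JEP (C : Set (Str L)) : Prop :=
  ∀ A ∈ C, ∀ B ∈ C, ∃ D ∈ C, Embeds A D ∧ Embeds B D

/-- Every pair of embeddings with domain `A` into members of `C` can be amalgamated
over `A` inside `C`. -/
def AmalgamatesOver (C : Set (Str L)) (A : Str L) : Prop :=
  ∀ B₀ ∈ C, ∀ B₁ ∈ C, ∀ f₀ f₁ : ℕ → ℕ, IsEmbMap A B₀ f₀ → IsEmbMap A B₁ f₁ →
    ∃ D ∈ C, ∃ g₀ g₁ : ℕ → ℕ, IsEmbMap B₀ D g₀ ∧ IsEmbMap B₁ D g₁ ∧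
      ∀ x ∈ A.dom, g₀ (f₀ x) = g₁ (f₁ x)

/-- The amalgamation property. -/
def AP (C : Set (Str L)) : Prop := ∀ A ∈ C, AmalgamatesOver C A

/-- `A` is an amalgamation base of the class `C`. -/
def AmalgBase (C : Set (Str L)) (A : Str L) : Prop := A ∈ C ∧ AmalgamatesOver C A

/-- The cofinal amalgamation property. -/
def CoAP (C : Set (Str L)) : Prop :=
  ∀ A ∈ C, ∃ A' : Str L, AmalgBase C A' ∧ Embeds A A'

/-! ### Computable ages -/

/-- An (abstract) enumerated age: for each index `i`, a generating tuple `tup i` and the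
structure `str i` it generates. -/
structure CompAge (L : Lang) where
  tup : ℕ → List ℕ
  str : ℕ → Str L
  tup_mem : ∀ i, TupleIn (str i) (tup i)
  gen : ∀ i x, x ∈ (str i).dom ↔ InClosure (str i) (tup i) x

/-- The class of structures represented by the enumerated age `K`. -/
def CompAge.cls (K : CompAge L) : Set (Str L) := { B | ∃ i, Isom B (K.str i) }

/-- The structure `M` is computable in the oracle set `s`. -/
def StrComputableIn (s : Set ℕ) (M : Str L) : Prop :=
  SetRecIn s M.dom ∧
  SetRecIn s { p | ∃ r as, TupleIn M as ∧ M.rel r as ∧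
      p = Nat.pair r (Encodable.encode as) } ∧
  SetRecIn s { p | ∃ f as b, L.funArity f = some as.length ∧ TupleIn M as ∧
      M.fn f as = b ∧ p = Nat.pair f (Nat.pair (Encodable.encode as) b) }

/-- The coded diagram of an enumerated age. -/
def CompAge.diag (K : CompAge L) : Set ℕ :=
  { p | ∃ i, p = Nat.pair 0 (Nat.pair i (Encodable.encode (K.tup i))) } ∪
  { p | ∃ i x, x ∈ (K.str i).dom ∧ p = Nat.pair 1 (Nat.pair i x) } ∪
  { p | ∃ i r as, TupleIn (K.str i) as ∧ (K.str i).rel r as ∧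
      p = Nat.pair 2 (Nat.pair i (Nat.pair r (Encodable.encode as))) } ∪
  { p | ∃ i r as, TupleIn (K.str i) as ∧ L.relArity r = some as.length ∧
      ¬ (K.str i).rel r as ∧
      p = Nat.pair 3 (Nat.pair i (Nat.pair r (Encodable.encode as))) } ∪
  { p | ∃ i f as b, TupleIn (K.str i) as ∧ L.funArity f = some as.length ∧
      (K.str i).fn f as = b ∧
      p = Nat.pair 4 (Nat.pair i (Nat.pair f (Nat.pair (Encodable.encode as) b))) }

/-- `K` is an `s`-computable age: its diagram is c.e. in `s` and each of its structures
is computable in `s`. -/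
def AgeComputableIn (s : Set ℕ) (K : CompAge L) : Prop :=
  CEIn s K.diag ∧ ∀ i, StrComputableIn s (K.str i)

/-- The embedding information of an enumerated age, as a set of naturals. -/
def EmbedInfo (K : CompAge L) : Set ℕ :=
  { p | ∃ k₀ b₀ k₁ b₁, TupleIn (K.str k₀) b₀ ∧ TupleIn (K.str k₁) b₁ ∧
      ClSim (K.str k₀) b₀ (K.str k₁) b₁ ∧
      p = Nat.pair k₀ (Nat.pair (Encodable.encode b₀)
            (Nat.pair k₁ (Encodable.encode b₁))) }

/-! ### Potential embeddings, spans, and amalgamation diagrams -/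

/-- A potential embedding: a pair of indices and a tuple in the codomain structure. -/
structure PotEmb where
  i : ℕ
  j : ℕ
  c : List ℕ

/-- A numerical code of a potential embedding. -/
def PotEmb.code (F : PotEmb) : ℕ :=
  Nat.pair F.i (Nat.pair F.j (Encodable.encode F.c))

/-- The potential embedding is well-formed with respect to `K`. -/
def PotEmb.Valid (K : CompAge L) (F : PotEmb) : Prop :=
  F.c.length = (K.tup F.i).length ∧ TupleIn (K.str F.j) F.c

/-- The potential embedding is an embedding. -/
def PotEmb.IsEmb (K : CompAge L) (F : PotEmb) : Prop :=
  ClSim (K.str F.i) (K.tup F.i) (K.str F.j) F.c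

/-- The potential embedding is an isomorphism (its range generates the codomain). -/
def PotEmb.IsIso (K : CompAge L) (F : PotEmb) : Prop :=
  F.IsEmb K ∧ ∀ x ∈ (K.str F.j).dom, InClosure (K.str F.j) F.c x

/-- `h` realizes the potential embedding `F` as a map on the domain structure. -/
def ExtMap (K : CompAge L) (F : PotEmb) (h : ℕ → ℕ) : Prop :=
  (K.tup F.i).map h = F.c ∧ IsEmbMap (K.str F.i) (K.str F.j) h

/-- `(F₀, F₁)` is a potential span. -/
def PotSpan (K : CompAge L) (F₀ F₁ : PotEmb) : Prop :=
  F₀.Valid K ∧ F₁.Valid K ∧ F₀.i = F₁.i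

/-- `(G₀, G₁)` is an amalgamation diagram over the potential span `(F₀, F₁)`. -/
def AmalgDiagOver (K : CompAge L) (F₀ F₁ G₀ G₁ : PotEmb) : Prop :=
  G₀.Valid K ∧ G₁.Valid K ∧ G₀.IsEmb K ∧
  G₀.i = F₀.j ∧ G₁.i = F₁.j ∧ G₀.j = G₁.j ∧
  (F₀.IsEmb K → F₁.IsEmb K → G₁.IsEmb K ∧
    ∀ h₀ h₁ : ℕ → ℕ, ExtMap K G₀ h₀ → ExtMap K G₁ h₁ →
      F₀.c.map h₀ = F₁.c.map h₁)

/-- `H` is the composition `F ∘ G` of potential embeddings (where `F` is an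
embedding realized by any `h` extending it). -/
def CompRel (K : CompAge L) (F G H : PotEmb) : Prop :=
  G.j = F.i ∧ H.i = G.i ∧ H.j = F.j ∧
  ∀ h : ℕ → ℕ, ExtMap K F h → H.c = G.c.map h

/-! ### Computable versions of HP, JEP, AP, coAP -/

/-- The `s`-computable hereditary property. -/
def CHP (s : Set ℕ) (K : CompAge L) : Prop :=
  ∃ c : OCode, ∀ i (b : List ℕ), TupleIn (K.str i) b →
    ∃ j, OCode.eval (chi s) c (Nat.pair i (Encodable.encode b)) = Part.some j ∧
      ClSim (K.str j) (K.tup j) (K.str i) b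

/-- The `s`-computable joint embedding property. -/
def CJEP (s : Set ℕ) (K : CompAge L) : Prop :=
  ∃ c : OCode, ∀ i j : ℕ, ∃ F G : PotEmb,
    OCode.eval (chi s) c (Nat.pair i j) = Part.some (Nat.pair F.code G.code) ∧
    F.Valid K ∧ G.Valid K ∧ F.IsEmb K ∧ G.IsEmb K ∧
    F.i = i ∧ G.i = j ∧ F.j = G.j

/-- The `s`-computable amalgamation property. -/
def CAP (s : Set ℕ) (K : CompAge L) : Prop :=
  ∃ c : OCode, ∀ F₀ F₁ : PotEmb, PotSpan K F₀ F₁ →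
    ∃ G₀ G₁ : PotEmb,
      OCode.eval (chi s) c (Nat.pair F₀.code F₁.code) =
        Part.some (Nat.pair G₀.code G₁.code) ∧
      AmalgDiagOver K F₀ F₁ G₀ G₁

/-- A family `W` of distinguished embeddings with amalgamation-base codomains, closed
under pre/post composition with isomorphisms, covering all domains. -/
def IsCoAPFamily (K : CompAge L) (W : Set PotEmb) : Prop :=
  (∀ F ∈ W, F.Valid K ∧ F.IsEmb K ∧ AmalgBase K.cls (K.str F.j)) ∧
  (∀ F ∈ W, ∀ G H : PotEmb, G.Valid K → G.IsIso K → G.j = F.i →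
      CompRel K F G H → H ∈ W) ∧
  (∀ F ∈ W, ∀ G H : PotEmb, G.Valid K → G.IsIso K → G.i = F.j →
      CompRel K G F H → H ∈ W) ∧
  (∀ i : ℕ, ∃ F ∈ W, F.i = i)

/-- The `s`-computable cofinal amalgamation property: there is an `s`-c.e. family of
distinguished embeddings onto amalgamation bases together with an `s`-computable
amalgamation function. -/
def CcoAP (s : Set ℕ) (K : CompAge L) : Prop :=
  ∃ W : Set PotEmb, IsCoAPFamily K W ∧
    CEIn s { p | ∃ F ∈ W, p = F.code } ∧
    ∃ c : OCode, ∀ F ∈ W, ∀ G₀ G₁ : PotEmb,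
      G₀.Valid K → G₁.Valid K → G₀.i = F.j → G₁.i = F.j →
      ∃ D₀ D₁ : PotEmb,
        OCode.eval (chi s) c (Nat.pair F.code (Nat.pair G₀.code G₁.code)) =
          Part.some (Nat.pair D₀.code D₁.code) ∧
        AmalgDiagOver K G₀ G₁ D₀ D₁

/-! ### Ultrahomogeneity -/

/-- `M` is ultrahomogeneous: every isomorphism between finitely generated substructures
extends to an automorphism. -/
def Ultrahomogeneous (M : Str L) : Prop :=
  ∀ as bs : List ℕ, TupleIn M as → TupleIn M bs → ClSim M as M bs →
    ∃ g : ℕ → ℕ, IsAutoOf M g ∧ as.map g = bs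

/-- `g` is a bijection of the underlying set of `M` with itself. -/
def BijOnDom (M : Str L) (g : ℕ → ℕ) : Prop :=
  (∀ x ∈ M.dom, g x ∈ M.dom) ∧
  (∀ x ∈ M.dom, ∀ y ∈ M.dom, g x = g y → x = y) ∧
  (∀ y ∈ M.dom, ∃ x ∈ M.dom, g x = y)

/-- `M` is `s`-computably ultrahomogeneous. -/
def CompUltrahom (s : Set ℕ) (M : Str L) : Prop :=
  ∃ c : OCode, ∀ as bs : List ℕ, TupleIn M as → TupleIn M bs →
    as.length = bs.length →
    ∃ e : ℕ,
      OCode.eval (chi s) c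
          (Nat.pair (Encodable.encode as) (Encodable.encode bs)) = Part.some e ∧
      ∃ c' : OCode, c'.encodeCode = e ∧ ∃ g : ℕ → ℕ, ComputesIn s c' g ∧
        BijOnDom M g ∧
        (ClSim M as M bs → IsAutoOf M g ∧ as.map g = bs)

/-! ### Cofinal ultrahomogeneity -/

/-- `M` is cofinally ultrahomogeneous. -/
def CofinallyUltrahomogeneous (M : Str L) : Prop :=
  ∀ as : List ℕ, TupleIn M as → ∃ bs : List ℕ, TupleIn M bs ∧
    (∀ x ∈ as, InClosure M bs x) ∧
    ∀ cs : List ℕ, TupleIn M cs → ClSim M bs M cs →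
      ∃ g : ℕ → ℕ, IsAutoOf M g ∧ bs.map g = cs

/-- `E` is a cofinal collection of tuples in `M`. -/
def IsCofinalCollection (M : Str L) (E : Set (List ℕ)) : Prop :=
  (∀ bs ∈ E, TupleIn M bs) ∧
  (∀ as : List ℕ, TupleIn M as → ∃ bs ∈ E, ∀ x ∈ as, InClosure M bs x) ∧
  (∀ bs ∈ E, ∀ as : List ℕ, (∀ x ∈ as, InClosure M bs x) → (as ++ bs) ∈ E) ∧
  (∀ as ∈ E, ∀ bs : List ℕ, TupleIn M bs → ClSim M as M bs → bs ∈ E)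

/-- `M` is cofinally ultrahomogeneous for the collection `E`: every isomorphism between
substructures generated by members of `E` extends to an automorphism. -/
def CofUltraFor (M : Str L) (E : Set (List ℕ)) : Prop :=
  ∀ as ∈ E, ∀ bs ∈ E, ClSim M as M bs →
    ∃ g : ℕ → ℕ, IsAutoOf M g ∧ as.map g = bs

/-- The set of codes of members of `E`. -/
def ECodes (E : Set (List ℕ)) : Set ℕ := { p | ∃ as ∈ E, p = Encodable.encode as }

/-- The functional part of `s`-computable cofinal ultrahomogeneity with respect to `E`. -/
def CofUltraFunIn (s : Set ℕ) (M : Str L) (E : Set (List ℕ)) : Prop :=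
  ∃ c : OCode, ∀ as ∈ E, ∀ bs : List ℕ, TupleIn M bs → TupleSim as bs →
    ∃ e : ℕ,
      OCode.eval (chi s) c
          (Nat.pair (Encodable.encode as) (Encodable.encode bs)) = Part.some e ∧
      ∃ c' : OCode, c'.encodeCode = e ∧ ∃ g : ℕ → ℕ, ComputesIn s c' g ∧
        BijOnDom M g ∧ as.map g = bs ∧
        (ClSim M as M bs → IsAutoOf M g)

/-- `M` is `s`-computably cofinally ultrahomogeneous with respect to `E`. -/
def CompCofUltrahomWrt (s : Set ℕ) (M : Str L) (E : Set (List ℕ)) : Prop :=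
  IsCofinalCollection M E ∧ SetRecIn s (ECodes E) ∧ CofUltraFunIn s M E

/-- `M` is `s`-computably cofinally ultrahomogeneous. -/
def CompCofUltrahom (s : Set ℕ) (M : Str L) : Prop :=
  ∃ E : Set (List ℕ), CompCofUltrahomWrt s M E

/-- The `s`-computable cofinal extension property with respect to `E`. -/
def CompCofExtProp (s : Set ℕ) (M : Str L) (E : Set (List ℕ)) : Prop :=
  ∃ c : OCode, ∀ as bs cs : List ℕ, as ∈ E → cs ∈ E → TupleIn M bs →
    (∀ x ∈ as, InClosure M cs x) → TupleSim as bs →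
    ∃ ds : List ℕ,
      OCode.eval (chi s) c
          (Nat.pair (Encodable.encode as)
            (Nat.pair (Encodable.encode bs) (Encodable.encode cs))) =
        Part.some (Encodable.encode ds) ∧
      TupleIn M ds ∧ TupleSim (as ++ cs) (bs ++ ds) ∧
      (ClSim M as M bs →
        ClSim M ds M cs ∧ (∀ x ∈ bs, InClosure M ds x) ∧
        ∀ h h' : ℕ → ℕ,
          ds.map h = cs → IsIsoMap (M.sub ds) (M.sub cs) h →
          bs.map h' = as → IsIsoMap (M.sub bs) (M.sub as) h' →
          bs.map h = bs.map h')

/-! ### Canonical ages and limits -/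

/-- `K` is a canonical age of `M` (relative to the oracle `t`): the enumeration of
generating tuples is `t`-computable, lists every finite tuple of `M` infinitely often,
and `str i` is the substructure generated by `tup i`. -/
def IsCanonicalAgeOf (t : Set ℕ) (K : CompAge L) (M : Str L) : Prop :=
  TotalComputableIn t (fun i => Encodable.encode (K.tup i)) ∧
  (∀ i, TupleIn M (K.tup i)) ∧
  (∀ as : List ℕ, TupleIn M as → ∀ n : ℕ, ∃ i, n ≤ i ∧ K.tup i = as) ∧
  (∀ i, K.str i = M.sub (K.tup i))

/-- `K` represents the age of `M`. -/
def RepresentsAgeOf (K : CompAge L) (M : Str L) : Prop :=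
  (∀ i, AgeMemOf M (K.str i)) ∧
  (∀ B : Str L, AgeMemOf M B → ∃ i, Isom B (K.str i))

/-- `M` is a cofinal Fraïssé limit of (the age represented by) `K`. -/
def CofinalFraisseLimitOf (K : CompAge L) (M : Str L) : Prop :=
  CofinallyUltrahomogeneous M ∧ RepresentsAgeOf K M

/-- The enumerated age `K` is uniformly finite. -/
def UniformlyFinite (K : CompAge L) : Prop :=
  L.FiniteLang ∧ ∃ f : ℕ → ℕ, TotalComputableIn ∅ f ∧
    ∀ i, ∀ as : List ℕ, TupleIn (K.str i) as →
      { x | InClosure (K.str i) as x }.Finite ∧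
      { x | InClosure (K.str i) as x }.ncard ≤ f as.length


/-! ### Closure properties of relative computability -/

namespace OCode

variable {O : ℕ →. ℕ}

theorem eval_comp_of_eval {cf cg : OCode} {n m : ℕ} (h : eval O cg n = Part.some m) :
    eval O (comp cf cg) n = eval O cf m := by
  simp only [eval, h]
  exact Part.bind_some _ _

theorem eval_pair_of_eval {cf cg : OCode} {n k m : ℕ} (hf : eval O cf n = Part.some k)
    (hg : eval O cg n = Part.some m) : eval O (pair cf cg) n = Part.some (Nat.pair k m) := by
  simp [eval, hf, hg, Seq.seq]

/-- A code for the identity function. -/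
protected def id : OCode := pair left right

theorem eval_id (n : ℕ) : eval O OCode.id n = Part.some n := by
  have h : eval O OCode.id n = Part.some (Nat.pair n.unpair.1 n.unpair.2) :=
    eval_pair_of_eval rfl rfl
  rwa [Nat.pair_unpair] at h

/-- A code for the unbounded search for a zero of the function computed by `c`. -/
def find (c : OCode) : OCode := comp (rfind' c) (pair OCode.id zero)

theorem eval_find (c : OCode) (a : ℕ) :
    eval O c.find a =
      Nat.rfind fun n => (eval O c (Nat.pair a n)).map fun m => decide (m = 0) := by
  have h : eval O (pair OCode.id zero) a = Part.some (Nat.pair a 0) :=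
    eval_pair_of_eval (eval_id a) rfl
  rw [find, eval_comp_of_eval h]
  simp only [eval, Nat.unpaired, Nat.unpair_pair, add_zero]
  exact Part.map_id' (fun _ => rfl) _

end OCode

theorem RecFunIn.of_partrec (O : Set ℕ) {f : ℕ →. ℕ} (hf : Nat.Partrec f) : RecFunIn O f := by
  induction hf with
  | zero => exact ⟨.zero, rfl⟩
  | succ => exact ⟨.succ, rfl⟩
  | left => exact ⟨.left, rfl⟩
  | right => exact ⟨.right, rfl⟩
  | pair _ _ ihf ihg =>
    obtain ⟨cf, rfl⟩ := ihf
    obtain ⟨cg, rfl⟩ := ihg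
    exact ⟨.pair cf cg, rfl⟩
  | comp _ _ ihf ihg =>
    obtain ⟨cf, rfl⟩ := ihf
    obtain ⟨cg, rfl⟩ := ihg
    exact ⟨.comp cf cg, rfl⟩
  | prec _ _ ihf ihg =>
    obtain ⟨cf, rfl⟩ := ihf
    obtain ⟨cg, rfl⟩ := ihg
    exact ⟨.prec cf cg, rfl⟩
  | rfind _ ihf =>
    obtain ⟨cf, rfl⟩ := ihf
    exact ⟨cf.find, funext fun a => OCode.eval_find cf a⟩

theorem OCode.partrec_eval_empty (c : OCode) : Nat.Partrec (OCode.eval (chi ∅) c) := by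
  induction c with
  | zero => exact Nat.Partrec.zero
  | succ => exact Nat.Partrec.succ
  | left => exact Nat.Partrec.left
  | right => exact Nat.Partrec.right
  | oracle =>
    have h : OCode.eval (chi ∅) .oracle = pure 0 := by
      funext n
      simp [OCode.eval, chi, pure, PFun.pure]
    rw [h]
    exact Nat.Partrec.zero
  | pair _ _ ihf ihg => exact ihf.pair ihg
  | comp _ _ ihf ihg => exact ihf.comp ihg
  | prec _ _ ihf ihg => exact ihf.prec ihg
  | rfind' _ ihf => exact ihf.rfind'

theorem TotalComputableIn.computable {f : ℕ → ℕ} (hf : TotalComputableIn ∅ f) :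
    Computable f := by
  obtain ⟨c, hc⟩ := hf
  exact Partrec.nat_iff.2 (c.partrec_eval_empty.of_eq hc)

theorem SetRecIn.computable_indicator {A : Set ℕ} (hA : SetRecIn ∅ A) :
    Computable fun n => if n ∈ A then 1 else 0 := by
  obtain ⟨c, hc⟩ := hA
  exact TotalComputableIn.computable ⟨c, fun n => by rw [hc]; rfl⟩

section TotalComputableIn

variable {O : Set ℕ} {f g : ℕ → ℕ}

theorem TotalComputableIn.of_computable (hf : Computable f) : TotalComputableIn O f := by
  obtain ⟨c, hc⟩ := RecFunIn.of_partrec O (Partrec.nat_iff.1 hf)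
  exact ⟨c, fun n => by rw [hc]; rfl⟩

theorem TotalComputableIn.oracle : TotalComputableIn O fun n => if n ∈ O then 1 else 0 :=
  ⟨.oracle, fun _ => rfl⟩

theorem TotalComputableIn.comp (hf : TotalComputableIn O f) (hg : TotalComputableIn O g) :
    TotalComputableIn O fun n => f (g n) := by
  obtain ⟨cf, hf⟩ := hf
  obtain ⟨cg, hg⟩ := hg
  exact ⟨.comp cf cg, fun n => (OCode.eval_comp_of_eval (hg n)).trans (hf _)⟩

theorem TotalComputableIn.pair (hf : TotalComputableIn O f) (hg : TotalComputableIn O g) :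
    TotalComputableIn O fun n => Nat.pair (f n) (g n) := by
  obtain ⟨cf, hf⟩ := hf
  obtain ⟨cg, hg⟩ := hg
  exact ⟨.pair cf cg, fun n => OCode.eval_pair_of_eval (hf n) (hg n)⟩

theorem TotalComputableIn.prec (hf : TotalComputableIn O f) (hg : TotalComputableIn O g) :
    TotalComputableIn O fun p =>
      Nat.rec (f p.unpair.1) (fun y i => g (Nat.pair p.unpair.1 (Nat.pair y i))) p.unpair.2 := by
  obtain ⟨cf, hf⟩ := hf
  obtain ⟨cg, hg⟩ := hg
  refine ⟨.prec cf cg, fun p => ?_⟩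
  simp only [OCode.eval, Nat.unpaired]
  induction p.unpair.2 with
  | zero => exact hf _
  | succ k ih =>
    dsimp only
    rw [ih]
    exact (Part.bind_some _ _).trans (hg _)

theorem TotalComputableIn.exists_search (hf : TotalComputableIn O f) :
    ∃ c : OCode, ∀ a, (∃ w, f (Nat.pair a w) = 0) →
      ∃ w, f (Nat.pair a w) = 0 ∧ OCode.eval (chi O) c a = Part.some w := by
  obtain ⟨cf, hf⟩ := hf
  refine ⟨cf.find, fun a ha => ⟨Nat.find ha, Nat.find_spec ha, ?_⟩⟩
  rw [OCode.eval_find]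
  refine Part.eq_some_iff.2 (Nat.mem_rfind.2 ⟨?_, fun {m} hm => ?_⟩)
  · simpa [hf _] using Nat.find_spec ha
  · simpa [hf _] using Nat.find_min ha hm

theorem TotalComputableIn.exists_choice (hf : TotalComputableIn O f)
    (h : ∀ a, ∃ w, f (Nat.pair a w) = 0) :
    ∃ F : ℕ → ℕ, TotalComputableIn O F ∧ ∀ a, f (Nat.pair a (F a)) = 0 := by
  obtain ⟨c, hc⟩ := hf.exists_search
  choose F hF hcF using fun a => hc a (h a)
  exact ⟨F, ⟨c, hcF⟩, hF⟩

end TotalComputableIn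

/-! ### Currying of codes -/

/-- A code for the constant function with value `n`. -/
def OCode.const : ℕ → OCode
  | 0 => .zero
  | n + 1 => .comp .succ (OCode.const n)

theorem OCode.eval_const (O : ℕ →. ℕ) (n m : ℕ) :
    OCode.eval O (OCode.const n) m = Part.some n := by
  induction n with
  | zero => rfl
  | succ n ih => exact OCode.eval_comp_of_eval ih

/-- The code obtained from `c` by fixing the first component of the input to be `a`. -/
def OCode.curry (c : OCode) (a : ℕ) : OCode :=
  .comp c (.pair (OCode.const a) OCode.id)

theorem OCode.eval_curry (O : ℕ →. ℕ) (c : OCode) (a n : ℕ) :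
    OCode.eval O (c.curry a) n = OCode.eval O c (Nat.pair a n) := by
  exact OCode.eval_comp_of_eval
    (OCode.eval_pair_of_eval (OCode.eval_const O a n) (OCode.eval_id n))

theorem OCode.computable_encodeCode_curry (c : OCode) :
    Computable fun a => (c.curry a).encodeCode := by
  have hconst : Primrec fun n => (OCode.const n).encodeCode := by
    have h : Primrec (Nat.rec 0 fun _ i => 4 * Nat.pair 1 i + 6 : ℕ → ℕ) := by
      refine Primrec.nat_rec₁ 0 ?_
      exact Primrec.nat_add.comp (Primrec.nat_mul.comp (Primrec.const 4)
        (Primrec₂.natPair.comp (Primrec.const 1) Primrec.snd)) (Primrec.const 6)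
    refine h.of_eq fun n => ?_
    induction n with
    | zero => rfl
    | succ n ih => simp only [OCode.const, OCode.encodeCode, ← ih]
  refine Primrec.to_comp ?_
  exact Primrec.nat_add.comp (Primrec.nat_mul.comp (Primrec.const 4)
    (Primrec₂.natPair.comp (Primrec.const _)
      (Primrec.nat_add.comp (Primrec.nat_mul.comp (Primrec.const 4)
        (Primrec₂.natPair.comp hconst (Primrec.const _))) (Primrec.const 5)))) (Primrec.const 6)

/-! ### Generated substructures and automorphisms -/

section Structures

variable {M : Str L}

theorem Str.sub_sub_self (as : List ℕ) :
    (M.sub as).sub as = M.sub as := by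
  have h : ∀ x, InClosure (M.sub as) as x ↔ InClosure M as x := by
    refine fun x => ⟨fun hx => hx.mem_dom, fun hx => ?_⟩
    induction hx with
    | base hx hd => exact .base hx (InClosure.base hx hd)
    | fn f bs hf _ ih => exact InClosure.fn (A := M.sub as) f bs hf ih
  simp only [Str.sub, Str.mk.injEq]
  refine ⟨?_, ?_, trivial⟩
  · ext x; exact h x
  · funext r bs
    simp only [eq_iff_iff, and_assoc]
    constructor
    · exact fun ⟨h₁, h₂, _⟩ => ⟨h₁, h₂⟩
    · exact fun ⟨h₁, h₂⟩ => ⟨h₁, h₂, fun x hx => (h x).2 (h₂ x hx)⟩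

theorem InClosure.map {g : ℕ → ℕ} (hg : IsAutoOf M g) {as : List ℕ} {x : ℕ}
    (hx : InClosure M as x) : InClosure M (as.map g) (g x) := by
  induction hx with
  | base hx hd => exact .base (List.mem_map_of_mem hx) (hg.1.1 _ hd)
  | fn f bs hf hbs ih =>
    rw [hg.1.2.2.2 f bs hf fun x hx => (hbs x hx).mem_dom]
    refine .fn f _ (by simpa using hf) fun y hy => ?_
    obtain ⟨x, hx, rfl⟩ := List.mem_map.1 hy
    exact ih x hx

theorem InClosure.exists_of_map {g : ℕ → ℕ} (hg : IsAutoOf M g) {as : List ℕ}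
    (has : TupleIn M as) {y : ℕ} (hy : InClosure M (as.map g) y) :
    ∃ x, InClosure M as x ∧ g x = y := by
  induction hy with
  | base hy hd =>
    obtain ⟨x, hx, rfl⟩ := List.mem_map.1 hy
    exact ⟨x, .base hx (has x hx), rfl⟩
  | fn f bs hf _ ih =>
    choose! p hp hgp using ih
    have hmap : (bs.map p).map g = bs := by
      rw [List.map_map]
      exact (List.map_congr_left hgp).trans (List.map_id _)
    have hcl : ∀ x ∈ bs.map p, InClosure M as x := by
      intro x hx
      obtain ⟨y, hy, rfl⟩ := List.mem_map.1 hx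
      exact hp y hy
    have hlen : L.funArity f = some (bs.map p).length := by simpa using hf
    refine ⟨M.fn f (bs.map p), .fn f _ hlen hcl, ?_⟩
    rw [hg.1.2.2.2 f _ hlen fun x hx => (hcl x hx).mem_dom, hmap]

theorem IsAutoOf.clSim {g : ℕ → ℕ} (hg : IsAutoOf M g) {as : List ℕ} (has : TupleIn M as) :
    ClSim M as M (as.map g) := by
  refine ⟨g, rfl, ⟨fun x hx => InClosure.map hg hx,
    fun x hx y hy => hg.1.2.1 x hx.mem_dom y hy.mem_dom, fun r bs hbs => ?_,
    fun f bs hf hbs => hg.1.2.2.2 f bs hf fun x hx => (hbs x hx).mem_dom⟩,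
    fun y hy => InClosure.exists_of_map hg has hy⟩
  have h := hg.1.2.2.1 r bs fun x hx => (hbs x hx).mem_dom
  constructor
  · rintro ⟨h₁, -⟩
    refine ⟨h.1 h₁, fun y hy => ?_⟩
    obtain ⟨x, hx, rfl⟩ := List.mem_map.1 hy
    exact InClosure.map hg (hbs x hx)
  · exact fun h₁ => ⟨h.2 h₁.1, hbs⟩

theorem IsAutoOf.bijOnDom {g : ℕ → ℕ} (hg : IsAutoOf M g) : BijOnDom M g :=
  ⟨hg.1.1, hg.1.2.1, hg.2⟩

theorem bijOnDom_id : BijOnDom M fun x => x :=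
  ⟨fun _ h => h, fun _ _ _ _ h => h, fun y h => ⟨y, h, rfl⟩⟩

/-- One back-and-forth step: in an ultrahomogeneous structure, a partial isomorphism extends
to one whose domain and range contain a given element. -/
theorem Ultrahomogeneous.exists_extension (hu : Ultrahomogeneous M) {as bs : List ℕ}
    (has : TupleIn M as) (hbs : TupleIn M bs) (h : ClSim M as M bs) (t : ℕ) :
    ∃ as' bs', TupleIn M as' ∧ TupleIn M bs' ∧ as <+: as' ∧ bs <+: bs' ∧ ClSim M as' M bs' ∧
      (t ∈ M.dom → t ∈ as' ∧ t ∈ bs') := by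
  by_cases ht : t ∈ M.dom
  · obtain ⟨g, hg, rfl⟩ := hu as bs has hbs h
    obtain ⟨x, hx, hgx⟩ := hg.2 t ht
    have hd : TupleIn M (as ++ [t, x]) := by
      intro y hy
      simp only [List.mem_append, List.mem_cons, List.not_mem_nil, or_false] at hy
      rcases hy with hy | rfl | rfl
      exacts [has y hy, ht, hx]
    refine ⟨as ++ [t, x], (as ++ [t, x]).map g, hd, ?_, List.prefix_append _ _,
      ?_, hg.clSim hd, fun _ => ⟨by simp, by simp [hgx]⟩⟩
    · intro y hy
      obtain ⟨z, hz, rfl⟩ := List.mem_map.1 hy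
      exact hg.1.1 z (hd z hz)
    · rw [List.map_append]
      exact List.prefix_append _ _
  · exact ⟨as, bs, has, hbs, List.prefix_rfl, List.prefix_rfl, h, fun h' => absurd h' ht⟩

/-- The limit of a back-and-forth sequence of partial isomorphisms is an automorphism. -/
theorem isAutoOf_limit {A B : ℕ → List ℕ} (hA : ∀ n, TupleIn M (A n))
    (hsim : ∀ n, ClSim M (A n) M (B n)) (hpA : ∀ n, A n <+: A (n + 1))
    (hpB : ∀ n, B n <+: B (n + 1))
    (hdom : ∀ t ∈ M.dom, t ∈ A (t + 1) ∧ t ∈ B (t + 1)) :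
    IsAutoOf M (fun x => (B (x + 1)).getD ((A (x + 1)).idxOf x) 0) ∧
      (A 0).map (fun x => (B (x + 1)).getD ((A (x + 1)).idxOf x) 0) = B 0 := by
  choose h hmap hiso using hsim
  set g : ℕ → ℕ := fun x => (B (x + 1)).getD ((A (x + 1)).idxOf x) 0 with hg
  have monoA : ∀ {m n}, m ≤ n → A m <+: A n := fun hmn =>
    Nat.le_induction List.prefix_rfl (fun n _ ih => ih.trans (hpA n)) _ hmn
  have monoB : ∀ {m n}, m ≤ n → B m <+: B n := fun hmn =>
    Nat.le_induction List.prefix_rfl (fun n _ ih => ih.trans (hpB n)) _ hmn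
  have agree : ∀ {m n}, m ≤ n → ∀ x ∈ A m, h n x = h m x := by
    intro m n hmn
    obtain ⟨u, hu⟩ := monoA hmn
    obtain ⟨v, hv⟩ := monoB hmn
    have e := hmap n
    rw [← hu, ← hv, List.map_append] at e
    have e' := List.append_inj_left e (by rw [List.length_map, ← hmap m, List.length_map])
    rw [← hmap m] at e'
    exact List.map_inj_left.1 e'
  have gself : ∀ x ∈ M.dom, g x = h (x + 1) x := by
    intro x hx
    have hlt := List.idxOf_lt_length_of_mem (hdom x hx).1
    simp only [hg, ← hmap (x + 1)]
    rw [List.getD_eq_getElem _ _ (by simpa using hlt), List.getElem_map, List.getElem_idxOf]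
  have geq : ∀ n, ∀ x ∈ A n, g x = h n x := by
    intro n x hx
    have hx' := hA n x hx
    rw [gself x hx', ← agree (le_max_left (x + 1) n) x (hdom x hx').1,
      ← agree (le_max_right (x + 1) n) x hx]
  have cover : ∀ as, TupleIn M as → ∃ n, ∀ x ∈ as, x ∈ A n := by
    intro as
    induction as with
    | nil => exact fun _ => ⟨0, by simp⟩
    | cons a as ih =>
      intro has
      obtain ⟨n, hn⟩ := ih fun x hx => has x (List.mem_cons_of_mem _ hx)
      refine ⟨max n (a + 1), fun x hx => ?_⟩
      rcases List.mem_cons.1 hx with rfl | hx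
      · exact (monoA (le_max_right _ _)).subset (hdom x (has x List.mem_cons_self)).1
      · exact (monoA (le_max_left _ _)).subset (hn x hx)
  have cl : ∀ {n x}, x ∈ A n → InClosure M (A n) x := fun hx => .base hx (hA _ _ hx)
  refine ⟨⟨⟨fun x hx => ?_, fun x hx y hy hxy => ?_, fun r as has => ?_,
    fun f as hf has => ?_⟩, fun y hy => ?_⟩, ?_⟩
  · rw [gself x hx]
    exact InClosure.mem_dom ((hiso (x + 1)).1.1 x (cl (hdom x hx).1))
  · obtain ⟨n, hn⟩ := cover [x, y] (by simp [TupleIn, hx, hy])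
    have hxn := hn x (by simp)
    have hyn := hn y (by simp)
    rw [geq n x hxn, geq n y hyn] at hxy
    exact (hiso n).1.2.1 x (cl hxn) y (cl hyn) hxy
  · obtain ⟨n, hn⟩ := cover as has
    rw [List.map_congr_left fun x hx => geq n x (hn x hx)]
    have e := (hiso n).1.2.2.1 r as fun x hx => cl (hn x hx)
    constructor
    · exact fun hr => (e.1 ⟨hr, fun x hx => cl (hn x hx)⟩).1
    · refine fun hr => (e.2 ⟨hr, fun y hy => ?_⟩).1
      obtain ⟨x, hx, rfl⟩ := List.mem_map.1 hy
      exact (hiso n).1.1 x (cl (hn x hx))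
  · obtain ⟨n, hn⟩ := cover (M.fn f as :: as) (by
      intro x hx
      rcases List.mem_cons.1 hx with rfl | hx
      exacts [M.fn_mem f as hf has, has x hx])
    have hn' : ∀ x ∈ as, x ∈ A n := fun x hx => hn x (List.mem_cons_of_mem _ hx)
    rw [List.map_congr_left fun x hx => geq n x (hn' x hx), geq n _ (hn _ List.mem_cons_self)]
    exact (hiso n).1.2.2.2 f as hf fun x hx => cl (hn' x hx)
  · have hyB := (hdom y hy).2
    rw [← hmap (y + 1)] at hyB
    obtain ⟨x, hx, hxy⟩ := List.mem_map.1 hyB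
    exact ⟨x, hA _ x hx, by rw [geq _ x hx, hxy]⟩
  · rw [List.map_congr_left fun x hx => geq 0 x hx, hmap 0]

end Structures

/-! ### The effective back-and-forth construction -/

theorem mem_embedInfo_iff {K : CompAge L} {k₀ k₁ : ℕ} {b₀ b₁ : List ℕ} :
    Nat.pair k₀ (Nat.pair (Encodable.encode b₀) (Nat.pair k₁ (Encodable.encode b₁))) ∈
        EmbedInfo K ↔
      TupleIn (K.str k₀) b₀ ∧ TupleIn (K.str k₁) b₁ ∧ ClSim (K.str k₀) b₀ (K.str k₁) b₁ := by
  constructor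
  · rintro ⟨k₀', b₀', k₁', b₁', h₀, h₁, h, e⟩
    simp only [Nat.pair_eq_pair, Encodable.encode_inj] at e
    obtain ⟨rfl, rfl, rfl, rfl⟩ := e
    exact ⟨h₀, h₁, h⟩
  · exact fun ⟨h₀, h₁, h⟩ => ⟨k₀, b₀, k₁, b₁, h₀, h₁, h, rfl⟩

/-- The query to the embedding information asking whether the generating tuples of the two
structures coded by `s` are similar. -/
def simQuery (K : CompAge L) (s : ℕ) : ℕ :=
  Nat.pair s.unpair.1 (Nat.pair (Encodable.encode (K.tup s.unpair.1))
    (Nat.pair s.unpair.2 (Encodable.encode (K.tup s.unpair.2))))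

section CanonicalAge

variable {M : Str L} {K : CompAge L}

theorem simQuery_mem_iff (hmem : ∀ i, TupleIn M (K.tup i))
    (hstr : ∀ i, K.str i = M.sub (K.tup i)) (s : ℕ) :
    simQuery K s ∈ EmbedInfo K ↔ ClSim M (K.tup s.unpair.1) M (K.tup s.unpair.2) := by
  rw [simQuery, mem_embedInfo_iff]
  unfold ClSim
  rw [hstr, hstr, Str.sub_sub_self, Str.sub_sub_self]
  have hself : ∀ i, TupleIn (M.sub (K.tup i)) (K.tup i) :=
    fun i x hx => InClosure.base hx (hmem i x hx)
  exact ⟨fun h => h.2.2, fun h => ⟨hself _, hself _, h⟩⟩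

theorem totalComputableIn_sim (htup : Computable K.tup) :
    TotalComputableIn (EmbedInfo K) fun s => if simQuery K s ∈ EmbedInfo K then 1 else 0 := by
  refine TotalComputableIn.oracle.comp (TotalComputableIn.of_computable ?_)
  have h₁ : Computable fun s : ℕ => s.unpair.1 := Computable.fst.comp Computable.unpair
  have h₂ : Computable fun s : ℕ => s.unpair.2 := Computable.snd.comp Computable.unpair
  have hp := Primrec₂.natPair.to_comp
  exact hp.comp h₁ (hp.comp (Computable.encode.comp (htup.comp h₁))
    (hp.comp h₂ (Computable.encode.comp (htup.comp h₂))))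

/-- The decidable part of the condition on a back-and-forth step. -/
def StepCond (A B A' B' : List ℕ) (t d : ℕ) : Prop :=
  (A'.take A.length = A ∧ B'.take B.length = B) ∧
    (d = 0 ∨ (A'.idxOf t < A'.length ∧ B'.idxOf t < B'.length))

theorem stepCond_iff {A B A' B' : List ℕ} {t d : ℕ} :
    StepCond A B A' B' t d ↔ A <+: A' ∧ B <+: B' ∧ (d ≠ 0 → t ∈ A' ∧ t ∈ B') := by
  simp only [StepCond, List.prefix_iff_eq_take, List.idxOf_lt_length_iff, and_assoc,
    eq_comm (a := A), eq_comm (a := B)]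
  tauto

theorem primrecPred_stepCond : PrimrecPred fun p :
    ((List ℕ × List ℕ) × List ℕ × List ℕ) × ℕ × ℕ =>
      StepCond p.1.1.1 p.1.1.2 p.1.2.1 p.1.2.2 p.2.1 p.2.2 := by
  have hA : Primrec fun p : ((List ℕ × List ℕ) × List ℕ × List ℕ) × ℕ × ℕ => p.1.1.1 :=
    Primrec.fst.comp (Primrec.fst.comp Primrec.fst)
  have hB : Primrec fun p : ((List ℕ × List ℕ) × List ℕ × List ℕ) × ℕ × ℕ => p.1.1.2 :=
    Primrec.snd.comp (Primrec.fst.comp Primrec.fst)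
  have hA' : Primrec fun p : ((List ℕ × List ℕ) × List ℕ × List ℕ) × ℕ × ℕ => p.1.2.1 :=
    Primrec.fst.comp (Primrec.snd.comp Primrec.fst)
  have hB' : Primrec fun p : ((List ℕ × List ℕ) × List ℕ × List ℕ) × ℕ × ℕ => p.1.2.2 :=
    Primrec.snd.comp (Primrec.snd.comp Primrec.fst)
  have ht : Primrec fun p : ((List ℕ × List ℕ) × List ℕ × List ℕ) × ℕ × ℕ => p.2.1 :=
    Primrec.fst.comp Primrec.snd
  have hd : Primrec fun p : ((List ℕ × List ℕ) × List ℕ × List ℕ) × ℕ × ℕ => p.2.2 :=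
    Primrec.snd.comp Primrec.snd
  exact ((Primrec.eq.comp (Primrec.list_take.comp (Primrec.list_length.comp hA) hA') hA).and
    (Primrec.eq.comp (Primrec.list_take.comp (Primrec.list_length.comp hB) hB') hB)).and
    ((Primrec.eq.comp hd (Primrec.const 0)).or
      ((Primrec.nat_lt.comp (Primrec.list_idxOf.comp ht hA') (Primrec.list_length.comp hA')).and
        (Primrec.nat_lt.comp (Primrec.list_idxOf.comp ht hB') (Primrec.list_length.comp hB'))))

/-- There is a computable back-and-forth step function on pairs of indices. -/
theorem exists_step (hu : Ultrahomogeneous M) (hdom : SetRecIn ∅ M.dom)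
    (htup : Computable K.tup) (hmem : ∀ i, TupleIn M (K.tup i))
    (hsurj : ∀ as, TupleIn M as → ∃ i, K.tup i = as)
    (hstr : ∀ i, K.str i = M.sub (K.tup i)) :
    ∃ F : ℕ → ℕ, TotalComputableIn (EmbedInfo K) F ∧ ∀ a t s,
      ClSim M (K.tup s.unpair.1) M (K.tup s.unpair.2) →
      let w := F (Nat.pair a (Nat.pair t s))
      ClSim M (K.tup w.unpair.1) M (K.tup w.unpair.2) ∧
        K.tup s.unpair.1 <+: K.tup w.unpair.1 ∧ K.tup s.unpair.2 <+: K.tup w.unpair.2 ∧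
        (t ∈ M.dom → t ∈ K.tup w.unpair.1 ∧ t ∈ K.tup w.unpair.2) := by
  set d : ℕ → ℕ := fun n => if n ∈ M.dom then 1 else 0 with hd
  set σ : ℕ → ℕ := fun s => if simQuery K s ∈ EmbedInfo K then 1 else 0 with hσ
  have hdc : Computable d := hdom.computable_indicator
  have hσ' : ∀ s, σ s ≠ 0 ↔ ClSim M (K.tup s.unpair.1) M (K.tup s.unpair.2) := by
    intro s
    rw [← simQuery_mem_iff hmem hstr]
    simp [hσ]
  set st : ℕ → ℕ := fun p => p.unpair.1.unpair.2.unpair.2 with hst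
  set tm : ℕ → ℕ := fun p => p.unpair.1.unpair.2.unpair.1 with htm
  set wt : ℕ → ℕ := fun p => p.unpair.2 with hwt
  have h₁ : Computable fun s : ℕ => s.unpair.1 := Computable.fst.comp Computable.unpair
  have h₂ : Computable fun s : ℕ => s.unpair.2 := Computable.snd.comp Computable.unpair
  have cst : Computable st := h₂.comp (h₂.comp h₁)
  have ctm : Computable tm := h₁.comp (h₂.comp h₁)
  have cwt : Computable wt := h₂
  set ρ : ℕ → ℕ := fun p => if StepCond (K.tup (st p).unpair.1) (K.tup (st p).unpair.2)
    (K.tup (wt p).unpair.1) (K.tup (wt p).unpair.2) (tm p) (d (tm p)) then 1 else 0 with hρ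
  have cρ : Computable ρ := by
    have c₀ : Computable fun p : ((List ℕ × List ℕ) × List ℕ × List ℕ) × ℕ × ℕ =>
        if StepCond p.1.1.1 p.1.1.2 p.1.2.1 p.1.2.2 p.2.1 p.2.2 then 1 else 0 :=
      (Primrec.ite primrecPred_stepCond (Primrec.const 1) (Primrec.const 0)).to_comp
    exact c₀.comp ((((htup.comp (h₁.comp cst)).pair (htup.comp (h₂.comp cst))).pair
      ((htup.comp (h₁.comp cwt)).pair (htup.comp (h₂.comp cwt)))).pair
        (ctm.pair (hdc.comp ctm)))
  have cσ : TotalComputableIn (EmbedInfo K) σ := totalComputableIn_sim htup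
  have cκ : Computable fun p : ℕ =>
      if p.unpair.1 = 0 ∨ (p.unpair.2.unpair.1 ≠ 0 ∧ p.unpair.2.unpair.2 ≠ 0) then 0 else 1 := by
    have q₁ : Primrec fun s : ℕ => s.unpair.1 := Primrec.fst.comp Primrec.unpair
    have q₂ : Primrec fun s : ℕ => s.unpair.2 := Primrec.snd.comp Primrec.unpair
    exact (Primrec.ite ((Primrec.eq.comp q₁ (Primrec.const 0)).or
      ((Primrec.eq.comp (q₁.comp q₂) (Primrec.const 0)).not.and
        (Primrec.eq.comp (q₂.comp q₂) (Primrec.const 0)).not))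
      (Primrec.const 0) (Primrec.const 1)).to_comp
  have hq := (TotalComputableIn.of_computable (O := EmbedInfo K) cκ).comp
    ((cσ.comp (.of_computable cst)).pair
      ((cσ.comp (.of_computable cwt)).pair (.of_computable cρ)))
  obtain ⟨F, hF, hFs⟩ := hq.exists_choice (by
    intro a
    by_cases hs : σ a.unpair.2.unpair.2 = 0
    · exact ⟨0, by simp [hst, hs]⟩
    · obtain ⟨as, bs, has, hbs, ha, hb, hsim, ht⟩ := hu.exists_extension (hmem _) (hmem _)
        ((hσ' _).1 hs) a.unpair.2.unpair.1
      obtain ⟨i, rfl⟩ := hsurj as has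
      obtain ⟨j, rfl⟩ := hsurj bs hbs
      have hw : σ (Nat.pair i j) ≠ 0 := (hσ' _).2 (by simpa using hsim)
      refine ⟨Nat.pair i j, ?_⟩
      simp only [Nat.unpair_pair, ite_eq_left_iff, one_ne_zero, imp_false, not_not]
      refine Or.inr ⟨by simpa [hwt] using hw, ?_⟩
      simp only [hρ, hst, htm, hwt, Nat.unpair_pair, ne_eq, ite_eq_right_iff, one_ne_zero,
        imp_false, not_not, stepCond_iff]
      refine ⟨ha, hb, fun hdt => ht ?_⟩
      simpa [hd] using hdt)
  refine ⟨F, hF, fun a t s hs => ?_⟩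
  have h := hFs (Nat.pair a (Nat.pair t s))
  simp only [Nat.unpair_pair, ite_eq_left_iff, one_ne_zero, imp_false, not_not] at h
  rcases h with h | ⟨h, h'⟩
  · exact absurd h ((hσ' _).2 (by simpa [hst] using hs))
  · simp only [hρ, hst, htm, hwt, Nat.unpair_pair, ne_eq, ite_eq_right_iff, one_ne_zero,
        imp_false, not_not, stepCond_iff] at h'
    refine ⟨(hσ' _).1 (by simpa [hwt] using h), h'.1, h'.2.1, fun htd => h'.2.2 ?_⟩
    simpa [hd] using htd

/-- A function computable in the embedding information which extends, uniformly, every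
isomorphism between generated substructures to an automorphism. -/
theorem exists_uniform_extension (hu : Ultrahomogeneous M) (hdom : SetRecIn ∅ M.dom)
    (htup : Computable K.tup) (hmem : ∀ i, TupleIn M (K.tup i))
    (hsurj : ∀ as, TupleIn M as → ∃ i, K.tup i = as)
    (hstr : ∀ i, K.str i = M.sub (K.tup i)) :
    ∃ G : ℕ → ℕ, TotalComputableIn (EmbedInfo K) G ∧ ∀ s,
      BijOnDom M (fun n => G (Nat.pair s n)) ∧
      (ClSim M (K.tup s.unpair.1) M (K.tup s.unpair.2) →
        IsAutoOf M (fun n => G (Nat.pair s n)) ∧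
          (K.tup s.unpair.1).map (fun n => G (Nat.pair s n)) = K.tup s.unpair.2) := by
  obtain ⟨F, hF, hFs⟩ := exists_step hu hdom htup hmem hsurj hstr
  set σ : ℕ → ℕ := fun s => if simQuery K s ∈ EmbedInfo K then 1 else 0 with hσ
  have cσ : TotalComputableIn (EmbedInfo K) σ := totalComputableIn_sim htup
  have hσ' : ∀ s, σ s ≠ 0 ↔ ClSim M (K.tup s.unpair.1) M (K.tup s.unpair.2) := by
    intro s
    rw [← simQuery_mem_iff hmem hstr]
    simp [hσ]
  set S : ℕ → ℕ → ℕ := fun s n => Nat.rec s (fun y i => F (Nat.pair s (Nat.pair y i))) n with hS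
  have cS : TotalComputableIn (EmbedInfo K) fun p => S p.unpair.1 p.unpair.2 :=
    (TotalComputableIn.of_computable Computable.id).prec hF
  have h₁ : Computable fun s : ℕ => s.unpair.1 := Computable.fst.comp Computable.unpair
  have h₂ : Computable fun s : ℕ => s.unpair.2 := Computable.snd.comp Computable.unpair
  have cS' : TotalComputableIn (EmbedInfo K) fun p => S p.unpair.1 (p.unpair.2 + 1) := by
    have c := cS.comp (TotalComputableIn.of_computable (O := EmbedInfo K)
      (Primrec₂.natPair.to_comp.comp h₁ (Computable.succ.comp h₂)))
    simpa using c
  have cV : Computable fun p : ℕ => bif decide (p.unpair.1 = 0) then p.unpair.2.unpair.1 else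
      (K.tup p.unpair.2.unpair.2.unpair.2).getD
        ((K.tup p.unpair.2.unpair.2.unpair.1).idxOf p.unpair.2.unpair.1) 0 := by
    refine Computable.cond ?_ (h₁.comp h₂) ?_
    · exact (Primrec.eq.decide.to_comp.comp h₁ (Computable.const 0))
    · exact (Primrec.list_getD 0).to_comp.comp (htup.comp (h₂.comp (h₂.comp h₂)))
        (Primrec.list_idxOf.to_comp.comp (h₁.comp h₂) (htup.comp (h₁.comp (h₂.comp h₂))))
  have cG := (TotalComputableIn.of_computable (O := EmbedInfo K) cV).comp
    ((cσ.comp (.of_computable h₁)).pair ((TotalComputableIn.of_computable h₂).pair cS'))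
  refine ⟨_, cG, fun s => ?_⟩
  by_cases hs : σ s = 0
  · simp only [Nat.unpair_pair, hs, decide_true, cond_true]
    exact ⟨bijOnDom_id, fun h => absurd hs ((hσ' s).2 h)⟩
  · simp only [Nat.unpair_pair, hs, decide_false, cond_false]
    have hsim : ∀ n, ClSim M (K.tup (S s n).unpair.1) M (K.tup (S s n).unpair.2) := by
      intro n
      induction n with
      | zero => exact (hσ' s).1 hs
      | succ n ih => exact (hFs s n _ ih).1
    have h := isAutoOf_limit (A := fun n => K.tup (S s n).unpair.1)
      (B := fun n => K.tup (S s n).unpair.2) (fun _ => hmem _) hsim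
      (fun n => (hFs s n _ (hsim n)).2.1) (fun n => (hFs s n _ (hsim n)).2.2.1)
      (fun t ht => (hFs s t _ (hsim t)).2.2.2 ht)
    exact ⟨h.1.bijOnDom, fun _ => h⟩

end CanonicalAge

/-- A computable ultrahomogeneous structure is
`EmbedInfo(M)`-computably ultrahomogeneous. -/
theorem ultrahom_implies_embedinfo_comp_ultrahom {L : Lang} (hL : L.ComputableRep)
    (M : Str L) (hM : StrComputableIn ∅ M)
    (hu : Ultrahomogeneous M) :
    ∀ K : CompAge L, IsCanonicalAgeOf ∅ K M → CompUltrahom (EmbedInfo K) M := by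
  rintro K ⟨htup, hmem, hall, hstr⟩
  have htup : Computable K.tup := Computable.encode_iff.1 htup.computable
  have hsurj : ∀ as, TupleIn M as → ∃ i, K.tup i = as := fun as has => by
    obtain ⟨i, -, hi⟩ := hall as has 0
    exact ⟨i, hi⟩
  obtain ⟨G, ⟨u, hG⟩, hGs⟩ := exists_uniform_extension hu hM.1 htup hmem hsurj hstr
  have cI : Computable fun p : ℕ =>
      bif decide (Nat.pair (Encodable.encode (K.tup p.unpair.2.unpair.1))
        (Encodable.encode (K.tup p.unpair.2.unpair.2)) = p.unpair.1) then 0 else 1 := by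
    have h₁ : Computable fun s : ℕ => s.unpair.1 := Computable.fst.comp Computable.unpair
    have h₂ : Computable fun s : ℕ => s.unpair.2 := Computable.snd.comp Computable.unpair
    refine Computable.cond ?_ (Computable.const 0) (Computable.const 1)
    exact Primrec.eq.decide.to_comp.comp (Primrec₂.natPair.to_comp.comp
      (Computable.encode.comp (htup.comp (h₁.comp h₂)))
      (Computable.encode.comp (htup.comp (h₂.comp h₂)))) h₁
  obtain ⟨ci, hci⟩ := (TotalComputableIn.of_computable (O := EmbedInfo K) cI).exists_search
  obtain ⟨cc, hcc⟩ := TotalComputableIn.of_computable (O := EmbedInfo K)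
    u.computable_encodeCode_curry
  refine ⟨.comp cc ci, fun as bs has hbs _ => ?_⟩
  obtain ⟨i, rfl⟩ := hsurj as has
  obtain ⟨j, rfl⟩ := hsurj bs hbs
  obtain ⟨w, hw, hev⟩ := hci (Nat.pair (Encodable.encode (K.tup i)) (Encodable.encode (K.tup j)))
    ⟨Nat.pair i j, by simp⟩
  have hw' : K.tup w.unpair.1 = K.tup i ∧ K.tup w.unpair.2 = K.tup j := by
    by_contra hne
    simp [Nat.pair_eq_pair, hne] at hw
  refine ⟨(u.curry w).encodeCode, ?_, u.curry w, rfl, fun n => G (Nat.pair w n),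
    fun n => by rw [OCode.eval_curry, hG], (hGs w).1, fun h => ?_⟩
  · exact (OCode.eval_comp_of_eval hev).trans (hcc w)
  · have := (hGs w).2
    rw [hw'.1, hw'.2] at this
    exact this h

end CFL
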